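/- Let R ≥ 4, ‖A‖ ≤ R (spectral norm), ‖x‖_2 ≤ R, ‖y‖_2 ≤ R, β ∈ (0, 0.1), and suppose ⟨exp(Ax) + Ax, 1_n⟩ ≥ β and ⟨exp(Ay) + Ay, 1_n⟩ ≥ β. Then the softmax-residual function f(x) = ⟨exp(Ax) + Ax, 1_n⟩^{-1}·(exp(Ax) + Ax) satisfies ‖f(x) − f(y)‖_2 ≤ 6β^{-2}·n·exp(3R²)·‖x − y‖_2. -/

import Mathlib

open Matrix

/-- Euclidean (ℓ₂) norm of a vector in ℝ^m. -/
noncomputable def vecNorm2 {m : ℕ} (v : Fin m → ℝ) : ℝ := Real.sqrt (∑ i, (v i) ^ 2)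

/-- ℓ₁ norm of a vector in ℝ^m. -/
noncomputable def vecNorm1 {m : ℕ} (v : Fin m → ℝ) : ℝ := ∑ i, |v i|

/-- Spectral norm of a matrix: operator norm of the induced map between Euclidean spaces. -/
noncomputable def specNorm {m k : ℕ} (A : Matrix (Fin m) (Fin k) ℝ) : ℝ :=
  ‖(Matrix.toEuclideanLin A).toContinuousLinearMap‖

/-- Loewner order: `U ⪯ V` iff `vᵀ U v ≤ vᵀ V v` for all vectors `v`. -/
def loewnerLE {m : ℕ} (U V : Matrix (Fin m) (Fin m) ℝ) : Prop :=
  ∀ v : Fin m → ℝ, v ⬝ᵥ (U *ᵥ v) ≤ v ⬝ᵥ (V *ᵥ v)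

variable {n d : ℕ}

/-- `exp(Ax)`, the entrywise exponential of `A x`. -/
noncomputable def expv (A : Matrix (Fin n) (Fin d) ℝ) (x : Fin d → ℝ) : Fin n → ℝ :=
  fun j => Real.exp (A.mulVec x j)

/-- `u(x) = exp(Ax) + Ax`. -/
noncomputable def uf (A : Matrix (Fin n) (Fin d) ℝ) (x : Fin d → ℝ) : Fin n → ℝ :=
  fun j => expv A x j + A.mulVec x j

/-- `α(x) = ⟨u(x), 1_n⟩`. -/
noncomputable def alphaf (A : Matrix (Fin n) (Fin d) ℝ) (x : Fin d → ℝ) : ℝ :=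
  ∑ j, uf A x j

/-- `f(x) = α(x)⁻¹ u(x)`. -/
noncomputable def ff (A : Matrix (Fin n) (Fin d) ℝ) (x : Fin d → ℝ) : Fin n → ℝ :=
  (alphaf A x)⁻¹ • uf A x

/-- `v_i(x) = (exp(Ax) + 1_n) ∘ A_{*,i}`. -/
noncomputable def vf (A : Matrix (Fin n) (Fin d) ℝ) (i : Fin d) (x : Fin d → ℝ) : Fin n → ℝ :=
  fun j => (expv A x j + 1) * A j i

/-- `c(x) = f(x) - b`. -/
noncomputable def cf (A : Matrix (Fin n) (Fin d) ℝ) (b : Fin n → ℝ) (x : Fin d → ℝ) : Fin n → ℝ :=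
  fun j => ff A x j - b j

/-- `L(x) = 0.5 ‖c(x)‖₂²`. -/
noncomputable def Lf (A : Matrix (Fin n) (Fin d) ℝ) (b : Fin n → ℝ) (x : Fin d → ℝ) : ℝ :=
  0.5 * ∑ j, (cf A b x j) ^ 2

/-- `z(x) = exp(Ax) + 1_n`. -/
noncomputable def zf (A : Matrix (Fin n) (Fin d) ℝ) (x : Fin d → ℝ) : Fin n → ℝ :=
  fun j => expv A x j + 1

/-- `K(x) = I_n - f(x) · 1_nᵀ`. -/
noncomputable def Kf (A : Matrix (Fin n) (Fin d) ℝ) (x : Fin d → ℝ) : Matrix (Fin n) (Fin n) ℝ :=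
  1 - vecMulVec (ff A x) (fun _ => 1)

/-- `c̃(x) = K(x)ᵀ c(x)`. -/
noncomputable def ctf (A : Matrix (Fin n) (Fin d) ℝ) (b : Fin n → ℝ) (x : Fin d → ℝ) : Fin n → ℝ :=
  (Kf A x)ᵀ *ᵥ cf A b x

/-- `B_mat(x) = α(x)⁻² diag(z(x)) K(x)ᵀ K(x) diag(z(x))`. -/
noncomputable def Bmat (A : Matrix (Fin n) (Fin d) ℝ) (x : Fin d → ℝ) : Matrix (Fin n) (Fin n) ℝ :=
  ((alphaf A x) ^ 2)⁻¹ • (diagonal (zf A x) * (Kf A x)ᵀ * Kf A x * diagonal (zf A x))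

/-- `B_rank(x) = α(x)⁻² (z(x) c̃(x)ᵀ diag(z(x)) + diag(z(x)) c̃(x) z(x)ᵀ)`. -/
noncomputable def Brank (A : Matrix (Fin n) (Fin d) ℝ) (b : Fin n → ℝ) (x : Fin d → ℝ) :
    Matrix (Fin n) (Fin n) ℝ :=
  ((alphaf A x) ^ 2)⁻¹ •
    (vecMulVec (zf A x) (ctf A b x) * diagonal (zf A x)
      + diagonal (zf A x) * vecMulVec (ctf A b x) (zf A x))

/-- `B_diag(x) = α(x)⁻¹ diag(c̃(x) ∘ exp(Ax))`. -/
noncomputable def Bdiag (A : Matrix (Fin n) (Fin d) ℝ) (b : Fin n → ℝ) (x : Fin d → ℝ) :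
    Matrix (Fin n) (Fin n) ℝ :=
  (alphaf A x)⁻¹ • diagonal (fun j => ctf A b x j * expv A x j)

/-- `B(x) = B_mat(x) - B_rank(x) + B_diag(x)`. -/
noncomputable def Bf (A : Matrix (Fin n) (Fin d) ℝ) (b : Fin n → ℝ) (x : Fin d → ℝ) :
    Matrix (Fin n) (Fin n) ℝ :=
  Bmat A x - Brank A b x + Bdiag A b x

/-- Hessian matrix of the loss `L`, with `H(x)_{ij} = ∂²L/∂x_i∂x_j`. -/
noncomputable def Hf (A : Matrix (Fin n) (Fin d) ℝ) (b : Fin n → ℝ) (x : Fin d → ℝ) :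
    Matrix (Fin d) (Fin d) ℝ :=
  Matrix.of fun i j =>
    fderiv ℝ (fun y => fderiv ℝ (Lf A b) y (Pi.single j 1)) x (Pi.single i 1)

theorem vn_eq {m : ℕ} (v : Fin m → ℝ) : vecNorm2 v = ‖WithLp.toLp 2 v‖ := by
  simp [vecNorm2, EuclideanSpace.norm_eq]

theorem vn_nonneg {m : ℕ} (v : Fin m → ℝ) : 0 ≤ vecNorm2 v := Real.sqrt_nonneg _

theorem vn_add {m : ℕ} (v w : Fin m → ℝ) : vecNorm2 (v + w) ≤ vecNorm2 v + vecNorm2 w := by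
  simp only [vn_eq, WithLp.toLp_add]
  exact norm_add_le _ _

theorem vn_smul {m : ℕ} (c : ℝ) (v : Fin m → ℝ) : vecNorm2 (c • v) = |c| * vecNorm2 v := by
  simp only [vn_eq, WithLp.toLp_smul, norm_smul, Real.norm_eq_abs]

theorem vn_mono {m : ℕ} (c : ℝ) (hc : 0 ≤ c) (v w : Fin m → ℝ) (h : ∀ i, |v i| ≤ c * |w i|) :
    vecNorm2 v ≤ c * vecNorm2 w := by
  have h1 : c * vecNorm2 w = vecNorm2 (c • w) := by rw [vn_smul, abs_of_nonneg hc]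
  rw [h1]
  unfold vecNorm2
  apply Real.sqrt_le_sqrt
  apply Finset.sum_le_sum
  intro i _
  apply sq_le_sq.mpr
  simpa [abs_mul, abs_of_nonneg hc] using h i

theorem vn_const {m : ℕ} (c : ℝ) (hc : 0 ≤ c) (v : Fin m → ℝ) (h : ∀ i, |v i| ≤ c) :
    vecNorm2 v ≤ c * Real.sqrt m := by
  have := vn_mono c hc v (fun _ => 1) (by simpa using h)
  simpa [vecNorm2] using this

theorem vn_coord {m : ℕ} (v : Fin m → ℝ) (i : Fin m) : |v i| ≤ vecNorm2 v := by
  unfold vecNorm2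
  apply Real.abs_le_sqrt
  exact Finset.single_le_sum (f := fun i => v i ^ 2) (fun j _ => sq_nonneg _) (Finset.mem_univ i)

theorem vn_sum {m : ℕ} (v : Fin m → ℝ) : |∑ i, v i| ≤ Real.sqrt m * vecNorm2 v := by
  unfold vecNorm2
  rw [← Real.sqrt_mul (by positivity)]
  apply Real.abs_le_sqrt
  simpa using sq_sum_le_card_mul_sum_sq (s := Finset.univ) (f := v)

theorem vn_mulVec {m k : ℕ} (A : Matrix (Fin m) (Fin k) ℝ) (x : Fin k → ℝ) :
    vecNorm2 (A *ᵥ x) ≤ specNorm A * vecNorm2 x := by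
  have := (Matrix.toEuclideanLin A).toContinuousLinearMap.le_opNorm (WithLp.toLp 2 x)
  simpa [vn_eq, specNorm] using this

theorem exp_lip (a b M : ℝ) (ha : a ≤ M) (hb : b ≤ M) :
    |Real.exp a - Real.exp b| ≤ Real.exp M * |a - b| := by
  wlog h : b ≤ a generalizing a b
  · rw [abs_sub_comm, abs_sub_comm a b]
    exact this b a hb ha (by linarith)
  rw [abs_of_nonneg (sub_nonneg.2 (Real.exp_le_exp.2 h)), abs_of_nonneg (sub_nonneg.2 h)]
  have h1 := Real.add_one_le_exp (b - a)
  have h2 : Real.exp b = Real.exp a * Real.exp (b - a) := by rw [← Real.exp_add]; congr 1; ring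
  have h3 : Real.exp a ≤ Real.exp M := Real.exp_le_exp.2 ha
  have h4 := Real.exp_pos a
  rw [h2]
  nlinarith [mul_le_mul_of_nonneg_right h3 (sub_nonneg.2 h)]

/-- ‖f(x) − f(y)‖₂ ≤ 6β⁻²·n·exp(3R²)·‖x − y‖₂. -/
theorem stmt16 (n d : ℕ) (A : Matrix (Fin n) (Fin d) ℝ) (x y : Fin d → ℝ) (R β : ℝ)
    (hR : 4 ≤ R) (hA : specNorm A ≤ R) (hx : vecNorm2 x ≤ R) (hy : vecNorm2 y ≤ R)
    (hβ0 : 0 < β) (hβ1 : β < 0.1)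
    (hβx : β ≤ alphaf A x) (hβy : β ≤ alphaf A y) :
    vecNorm2 (ff A x - ff A y)
      ≤ 6 * (β ^ 2)⁻¹ * (n : ℝ) * Real.exp (3 * R ^ 2) * vecNorm2 (x - y) := by
  have hn : (1 : ℝ) ≤ n := by
    rcases Nat.eq_zero_or_pos n with h | h
    · subst h
      simp [alphaf] at hβx
      linarith
    · exact_mod_cast h
  have hAx : ∀ z : Fin d → ℝ, vecNorm2 z ≤ R → ∀ j, |(A *ᵥ z) j| ≤ R ^ 2 := by
    intro z hz j
    calc _ ≤ vecNorm2 (A *ᵥ z) := vn_coord _ j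
      _ ≤ specNorm A * vecNorm2 z := vn_mulVec A z
      _ ≤ R * R := mul_le_mul hA hz (vn_nonneg _) (by linarith)
      _ = R ^ 2 := by ring
  set E := Real.exp (R ^ 2) with hE
  have hE1 : R ^ 2 + 1 ≤ E := Real.add_one_le_exp _
  have hE3 : Real.exp (3 * R ^ 2) = E ^ 3 := by
    rw [hE, ← Real.exp_nat_mul]; norm_num
  have hRE : R ≤ E := by nlinarith
  have hE0 : 17 ≤ E := by nlinarith
  set D := vecNorm2 (x - y) with hD
  have hD0 : 0 ≤ D := vn_nonneg _
  -- Lipschitz bound for u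
  have hU : vecNorm2 (uf A x - uf A y) ≤ (E + 1) * (R * D) := by
    have h1 : vecNorm2 (uf A x - uf A y) ≤ (E + 1) * vecNorm2 (A *ᵥ (x - y)) := by
      apply vn_mono _ (by linarith)
      intro j
      have e : (A *ᵥ (x - y)) j = (A *ᵥ x) j - (A *ᵥ y) j := by
        rw [Matrix.mulVec_sub]; rfl
      rw [e]
      have h2 := exp_lip _ _ _ (abs_le.1 (hAx x hx j)).2 (abs_le.1 (hAx y hy j)).2
      have e2 : (uf A x - uf A y) j = (Real.exp ((A *ᵥ x) j) - Real.exp ((A *ᵥ y) j))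
          + ((A *ᵥ x) j - (A *ᵥ y) j) := by
        simp only [uf, expv, Pi.sub_apply]; ring
      rw [e2]
      refine (abs_add_le _ _).trans ?_
      rw [add_mul, one_mul]
      linarith
    refine h1.trans (mul_le_mul_of_nonneg_left ?_ (by linarith))
    exact (vn_mulVec A _).trans (mul_le_mul_of_nonneg_right hA hD0)
  have hUy : vecNorm2 (uf A y) ≤ (2 * E - 1) * Real.sqrt n := by
    apply vn_const _ (by linarith)
    intro j
    have h1 := hAx y hy j
    have h2 : |Real.exp ((A *ᵥ y) j)| ≤ E := by
      rw [abs_of_pos (Real.exp_pos _)]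
      exact Real.exp_le_exp.2 (abs_le.1 h1).2
    have h3 : |uf A y j| ≤ |Real.exp ((A *ᵥ y) j)| + |(A *ᵥ y) j| := abs_add_le _ _
    linarith
  set W := vecNorm2 (uf A x - uf A y) with hW
  have hW0 : 0 ≤ W := vn_nonneg _
  have hal : |alphaf A y - alphaf A x| ≤ Real.sqrt n * W := by
    rw [abs_sub_comm]
    have := vn_sum (uf A x - uf A y)
    simpa [alphaf, Finset.sum_sub_distrib] using this
  have hax : 0 < alphaf A x := by linarith
  have hay : 0 < alphaf A y := by linarith
  have hix : (alphaf A x)⁻¹ ≤ β⁻¹ := inv_anti₀ hβ0 hβx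
  have hiy : (alphaf A y)⁻¹ ≤ β⁻¹ := inv_anti₀ hβ0 hβy
  have hinv : |(alphaf A x)⁻¹ - (alphaf A y)⁻¹| ≤ (β ^ 2)⁻¹ * (Real.sqrt n * W) := by
    have e : (alphaf A x)⁻¹ - (alphaf A y)⁻¹
        = ((alphaf A x)⁻¹ * (alphaf A y)⁻¹) * (alphaf A y - alphaf A x) := by
      field_simp
    rw [e, abs_mul, abs_of_pos (by positivity)]
    apply mul_le_mul _ hal (abs_nonneg _) (by positivity)
    calc _ ≤ β⁻¹ * β⁻¹ := mul_le_mul hix hiy (by positivity) (by positivity)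
      _ = _ := by rw [← mul_inv, sq]
  have hdec : ff A x - ff A y = (alphaf A x)⁻¹ • (uf A x - uf A y)
      + ((alphaf A x)⁻¹ - (alphaf A y)⁻¹) • uf A y := by
    unfold ff
    module
  have hb : β⁻¹ ≤ (β ^ 2)⁻¹ * 1 := by
    rw [mul_one]
    apply inv_anti₀ (by positivity)
    norm_num at hβ1
    nlinarith
  have hs : Real.sqrt n * Real.sqrt n = n := Real.mul_self_sqrt (by positivity)
  have hB : 0 < (β ^ 2)⁻¹ := by positivity
  rw [hE3, hdec]
  calc _ ≤ (alphaf A x)⁻¹ * W + |(alphaf A x)⁻¹ - (alphaf A y)⁻¹| * vecNorm2 (uf A y) := by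
        refine (vn_add _ _).trans ?_
        rw [vn_smul, vn_smul, abs_of_pos (inv_pos.2 hax)]
    _ ≤ ((β ^ 2)⁻¹ * 1) * W
        + ((β ^ 2)⁻¹ * (Real.sqrt n * W)) * ((2 * E - 1) * Real.sqrt n) := by
        apply add_le_add
        · exact mul_le_mul_of_nonneg_right (hix.trans hb) hW0
        · exact mul_le_mul hinv hUy (vn_nonneg _) (by positivity)
    _ = (β ^ 2)⁻¹ * (1 + (Real.sqrt n * Real.sqrt n) * (2 * E - 1)) * W := by ring
    _ = (β ^ 2)⁻¹ * (1 + n * (2 * E - 1)) * W := by rw [hs]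
    _ ≤ (β ^ 2)⁻¹ * (n * (2 * E)) * ((2 * E) * (E * D)) := by
        apply mul_le_mul _ _ hW0 (by positivity)
        · apply mul_le_mul_of_nonneg_left _ hB.le
          linarith
        · refine hU.trans ?_
          apply mul_le_mul (by linarith) _ (by positivity) (by linarith)
          exact mul_le_mul_of_nonneg_right hRE hD0
    _ = 4 * ((β ^ 2)⁻¹ * n * E ^ 3 * D) := by ring
    _ ≤ 6 * ((β ^ 2)⁻¹ * n * E ^ 3 * D) := by
        apply mul_le_mul_of_nonneg_right (by norm_num) (by positivity)
    _ = _ := by ring
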